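/- Suppose 2 ≤ 2δ < δ_max. Suppose κ ≥ 1 and H̃_0, H̃_1 are κ×n matrices over F_q such that: the nonzero rows of H̃_0 and H̃_1 taken together are linearly independent; H̃_0 has no zero row; and {v ∈ F_q^n : v·H̃_0ᵗ = 0 and v·H̃_1ᵗ = 0} = C, the narrow-sense BCH code of designed distance 2δ+1. Let G(D) = H̃_0 + H̃_1·D and V = {u(D)G(D) : u(D) ∈ F_q[D]^κ}. Then V is self-orthogonal with respect to the Euclidean inner product: for all u(D), w(D) ∈ F_q[D]^κ, the codewords v(D) = u(D)G(D) and x(D) = w(D)G(D) satisfy Σ_t v_t · x_t = 0, where v_t, x_t are the coefficient vectors of D^t. -/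

import Mathlib

/-- If `X` and `Y` are less than `q ^ ⌈r/2⌉ - 1 - (q - 2)[r odd]`, then `X q ^ i + Y` stays below
`q ^ r - 1` for all `i ≤ r / 2`. -/
theorem mul_pow_add_lt_pow_sub_one {q r i A X Y : ℕ} (hq : 2 ≤ q)
    (hA : A = q ^ ((r + 1) / 2) - 1 - (if r % 2 = 1 then q - 2 else 0))
    (hX : X < A) (hY : Y < A) (hi : i ≤ r / 2) :
    X * q ^ i + Y < q ^ r - 1 := by
  have h1 : X * q ^ i ≤ X * q ^ (r / 2) :=
    Nat.mul_le_mul_left _ (Nat.pow_le_pow_right (by omega) hi)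
  refine lt_of_le_of_lt (Nat.add_le_add_right h1 Y) ?_
  rcases Nat.even_or_odd' r with ⟨m, rfl | rfl⟩
  · rw [show (2 * m + 1) / 2 = m by omega, if_neg (by omega)] at hA
    rw [show 2 * m / 2 = m by omega, Nat.lt_sub_iff_add_lt, two_mul, pow_add]
    generalize q ^ m = P at *
    obtain ⟨P, rfl⟩ : ∃ k, P = k + 2 := ⟨P - 2, by omega⟩
    have hX' : X ≤ P := by omega
    have := Nat.mul_le_mul_right (P + 2) hX'
    nlinarith [show Y ≤ P by omega]
  · rw [show (2 * m + 1 + 1) / 2 = m + 1 by omega, if_pos (by omega), pow_succ] at hA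
    rw [show (2 * m + 1) / 2 = m by omega, Nat.lt_sub_iff_add_lt, two_mul, pow_succ, pow_add]
    generalize q ^ m = P at *
    obtain ⟨P, rfl⟩ : ∃ k, P = k + 1 := by
      rcases P with _ | k
      · omega
      · exact ⟨k, rfl⟩
    have e : (P + 1) * q = P * q + q := by ring
    have hX' : X ≤ P * q := by omega
    have := Nat.mul_le_mul_right (P + 1) hX'
    nlinarith [show Y ≤ P * q by omega]

/-- The set `{1, …, δmax - 1}` contains no `x`, `y` with `x q ^ i ≡ -y` modulo `n`. -/
theorem not_dvd_mul_pow_add {q n r δmax : ℕ} (hq : 2 ≤ q) (hr : 0 < r)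
    (hn : n ∣ q ^ r - 1)
    (hδmax : δmax = n * (q ^ ((r + 1) / 2) - 1 - (if r % 2 = 1 then q - 2 else 0)) / (q ^ r - 1))
    {x y i : ℕ} (hx : 0 < x) (hy : 0 < y) (hxδ : x < δmax) (hyδ : y < δmax) (hi : i < r) :
    ¬ n ∣ x * q ^ i + y := by
  have hpos : 0 < q ^ r - 1 := by
    have := Nat.one_lt_pow hr.ne' (show 1 < q by omega)
    omega
  obtain ⟨N, hN⟩ := hn
  have hn0 : 0 < n := Nat.pos_of_mul_pos_right (hN ▸ hpos)
  have hN0 : 0 < N := Nat.pos_of_mul_pos_left (hN ▸ hpos)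
  have key : ∀ {x y i : ℕ}, 0 < y → x < δmax → y < δmax → i ≤ r / 2 →
      ¬ n ∣ x * q ^ i + y := by
    intro x y i hy hxδ hyδ hi hd
    have bound : ∀ {z}, z < δmax → N * z <
        q ^ ((r + 1) / 2) - 1 - (if r % 2 = 1 then q - 2 else 0) := by
      intro z hz
      rw [hδmax, hN, Nat.mul_div_mul_left _ _ hn0] at hz
      have := (Nat.le_div_iff_mul_le hN0).1 (Nat.succ_le_of_lt hz)
      rw [Nat.succ_mul] at this
      nlinarith
    have h := mul_pow_add_lt_pow_sub_one hq rfl (bound hxδ) (bound hyδ) hi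
    have hd' : q ^ r - 1 ∣ N * x * q ^ i + N * y := by
      rw [hN, mul_comm n N, mul_assoc, ← mul_add]
      exact Nat.mul_dvd_mul_left N hd
    have := Nat.le_of_dvd (by positivity) hd'
    omega
  intro hd
  rcases le_or_gt i (r / 2) with h | h
  · exact key hy hxδ hyδ h hd
  · refine key (i := r - i) hx hyδ hxδ (by omega) ?_
    have h1 : n ∣ q ^ (r - i) * (x * q ^ i + y) := Dvd.dvd.mul_left hd _
    have e : q ^ (r - i) * (x * q ^ i + y) = (y * q ^ (r - i) + x) + n * (N * x) := by
      have e1 : q ^ (r - i) * q ^ i = n * N + 1 := by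
        rw [← pow_add, Nat.sub_add_cancel hi.le]
        omega
      linear_combination x * e1
    rw [e] at h1
    exact (Nat.dvd_add_left (dvd_mul_right n _)).1 h1

/-- The `k`-th powers of the `n`-th roots of unity sum to zero unless `n ∣ k`. -/
theorem IsPrimitiveRoot.sum_fin_pow_mul_eq_zero {E : Type*} [Field E] {n : ℕ} {γ : E}
    (hγ : IsPrimitiveRoot γ n) {k : ℕ} (hk : ¬ n ∣ k) :
    ∑ j : Fin n, γ ^ ((j : ℕ) * k) = 0 := by
  have h1 : γ ^ k ≠ 1 := fun h => hk (hγ.dvd_of_pow_eq_one k h)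
  have h2 : (∑ j ∈ Finset.range n, (γ ^ k) ^ j) = 0 := by
    rw [geom_sum_eq h1, ← pow_mul, mul_comm, pow_mul, hγ.pow_eq_one]
    simp
  rw [Finset.sum_range] at h2
  rw [← h2]
  exact Finset.sum_congr rfl fun j _ => by rw [mul_comm, pow_mul]

/-- If the defining set of a BCH code is disjoint from its negative, the dual of the code is
contained in the code. -/
theorem bch_sum_eq_zero_of_orthogonal {F E : Type*} [Field F] [Fintype F]
    [Field E] [Fintype E] [Algebra F E] {n d : ℕ} {γ : E} (hγ : IsPrimitiveRoot γ n)
    (hd : ∀ x y i : ℕ, 1 ≤ x → x ≤ d → 1 ≤ y → y ≤ d → i < Module.finrank F E →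
      ¬ n ∣ x * Fintype.card F ^ i + y)
    {b : Fin n → F}
    (hb : ∀ v : Fin n → F,
      (∀ z : ℕ, 1 ≤ z → z ≤ d → ∑ j : Fin n, algebraMap F E (v j) * γ ^ ((j : ℕ) * z) = 0) →
      b ⬝ᵥ v = 0)
    {z : ℕ} (hz : 1 ≤ z) (hzd : z ≤ d) :
    ∑ j : Fin n, algebraMap F E (b j) * γ ^ ((j : ℕ) * z) = 0 := by
  refine (traceForm_nondegenerate F E).1 _ fun α => ?_
  rw [← hb (fun j => Algebra.trace F E (γ ^ ((j : ℕ) * z) * α)) ?_]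
  · rw [Algebra.traceForm_apply, Finset.sum_mul, map_sum, dotProduct]
    refine Finset.sum_congr rfl fun j _ => ?_
    rw [mul_assoc, ← Algebra.smul_def, map_smul, smul_eq_mul]
  · intro y hy hyd
    simp_rw [FiniteField.algebraMap_trace_eq_sum_pow, Finset.sum_mul]
    rw [Finset.sum_comm]
    refine Finset.sum_eq_zero fun i hi => ?_
    have h := hγ.sum_fin_pow_mul_eq_zero (hd z y i hz hzd hy hyd (Finset.mem_range.1 hi))
    rw [Nat.card_eq_fintype_card]
    calc _ = ∑ j : Fin n, α ^ Fintype.card F ^ i *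
            γ ^ ((j : ℕ) * (z * Fintype.card F ^ i + y)) :=
          Finset.sum_congr rfl fun j _ => by rw [mul_pow, ← pow_mul, mul_add, pow_add]; ring
      _ = 0 := by rw [← Finset.mul_sum, h, mul_zero]

/-- The coefficient vectors of a codeword generated by `H0 + H1 D` lie in the span of the rows of
`H0` and `H1`. -/
theorem coeff_vecMul_unit_memory {F : Type*} [CommRing F] {ι κ : Type*} [Fintype κ]
    (H0 H1 : Matrix κ ι F) (u : κ → Polynomial F) (t : ℕ) :
    (fun j => (Matrix.vecMul u (H0.map Polynomial.C +
      H1.map fun a => Polynomial.C a * Polynomial.X) j).coeff t) =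
      Matrix.mulVec H0.transpose (fun k => (u k).coeff t) +
        Matrix.mulVec H1.transpose (fun k => (u k * Polynomial.X).coeff t) := by
  ext j
  simp only [Matrix.vecMul, Matrix.mulVec, dotProduct, Polynomial.finsetSum_coeff, Pi.add_apply,
    Matrix.add_apply, Matrix.map_apply, Matrix.transpose_apply, ← Finset.sum_add_distrib]
  refine Finset.sum_congr rfl fun k _ => ?_
  rw [mul_add, mul_left_comm, Polynomial.coeff_add, Polynomial.coeff_mul_C, Polynomial.coeff_C_mul,
    mul_comm]

/-- **Euclidean self-orthogonality of the unit-memory convolutional BCH code.**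
If `2 ≤ 2δ < δ_max`, the convolutional code `V` generated by
`G(D) = H̃₀ + H̃₁ D`, obtained from a parity check matrix of the narrow-sense
BCH code of designed distance `2δ+1`, is self-orthogonal: any two codewords
`v(D) = u(D)G(D)` and `x(D) = w(D)G(D)` satisfy `∑ₜ vₜ · xₜ = 0`. -/
theorem convolutional_BCH_euclidean_self_orthogonal
    {F E : Type*} [Field F] [Fintype F]
    [Field E] [Fintype E] [Algebra F E]
    {q n r δ κ : ℕ} (hq : Fintype.card F = q)
    (hn : 0 < n) (hgcd : Nat.gcd n q = 1)
    (hr : 0 < r) (hr1 : q ^ r ≡ 1 [MOD n])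
    (hrmin : ∀ s : ℕ, 0 < s → q ^ s ≡ 1 [MOD n] → r ≤ s)
    (hE : Fintype.card E = q ^ r)
    (γ : E) (hγ : IsPrimitiveRoot γ n)
    (δmax : ℕ)
    (hδmax : δmax = n * (q ^ ((r + 1) / 2) - 1 - (if r % 2 = 1 then q - 2 else 0)) / (q ^ r - 1))
    (hδ : 2 ≤ 2 * δ) (hδ2 : 2 * δ < δmax)
    (hκ : 1 ≤ κ)
    (H0 H1 : Matrix (Fin κ) (Fin n) F)
    (hind : LinearIndependent F
      (fun p : {p : Fin 2 × Fin κ // (![H0, H1] p.1) p.2 ≠ 0} => (![H0, H1] p.1.1) p.1.2))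
    (h0 : ∀ j : Fin κ, H0 j ≠ 0)
    (hC : ∀ v : Fin n → F, (H0.mulVec v = 0 ∧ H1.mulVec v = 0) ↔
      (∀ z : ℕ, 1 ≤ z → z ≤ 2 * δ → ∑ j : Fin n, algebraMap F E (v j) * γ ^ ((j : ℕ) * z) = 0))
    (G : Matrix (Fin κ) (Fin n) (Polynomial F))
    (hG : G = H0.map Polynomial.C + H1.map (fun a => Polynomial.C a * Polynomial.X))
    (u w : Fin κ → Polynomial F) :
    ∑ᶠ t : ℕ, ∑ j : Fin n,
      ((Matrix.vecMul u G) j).coeff t * ((Matrix.vecMul w G) j).coeff t = 0 := by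
  subst hq hG
  have hq : 2 ≤ Fintype.card F := Fintype.one_lt_card
  have hfin : Module.finrank F E = r :=
    Nat.pow_right_injective hq
      (by simpa [hE] using (Module.card_eq_pow_finrank (K := F) (V := E)).symm)
  have hdvd : n ∣ Fintype.card F ^ r - 1 :=
    (Nat.modEq_iff_dvd' (Nat.one_le_pow _ _ (by omega))).1 hr1.symm
  have hself : ∀ b : Fin n → F,
      (∀ v : Fin n → F, H0.mulVec v = 0 ∧ H1.mulVec v = 0 → b ⬝ᵥ v = 0) →
      H0.mulVec b = 0 ∧ H1.mulVec b = 0 := fun b hb =>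
    (hC b).2 fun z hz hzd => bch_sum_eq_zero_of_orthogonal hγ
      (fun x y i hx hxd hy hyd hi => not_dvd_mul_pow_add hq hr hdvd hδmax hx hy
        (by omega) (by omega) (hfin ▸ hi))
      (fun v hv => hb v ((hC v).2 hv)) hz hzd
  have hspan : ∀ a c : Fin κ → F, ∀ v : Fin n → F, H0.mulVec v = 0 ∧ H1.mulVec v = 0 →
      (H0.transpose.mulVec a + H1.transpose.mulVec c) ⬝ᵥ v = 0 := by
    rintro a c v ⟨hv0, hv1⟩
    rw [Matrix.mulVec_transpose, Matrix.mulVec_transpose, add_dotProduct,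
      ← Matrix.dotProduct_mulVec, ← Matrix.dotProduct_mulVec, hv0, hv1]
    simp
  refine finsum_eq_zero_of_forall_eq_zero fun t => ?_
  change (fun j => (Matrix.vecMul u _ j).coeff t) ⬝ᵥ (fun j => (Matrix.vecMul w _ j).coeff t) = 0
  rw [coeff_vecMul_unit_memory, coeff_vecMul_unit_memory]
  exact hspan _ _ _ (hself _ (hspan _ _))
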